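/- Wasserstein Bregman divergence identity (Lemma 3.5): Let p = N(m_p, Σ_p) and q = N(m_q, Σ_q) be Gaussians with positive-definite covariances, and let T_{q→p} be the optimal transport map from q to p. Then E_{Y∼q}[ D_U( T_{q→p}(Y), Y ) ] = ∫ U dp − ∫ U dq − E_{Y∼q}⟨ G_q(Y), T_{q→p}(Y) − Y ⟩, where G_q(y) = ∫ ∇U dq + (∫ ∇²U dq)(y − m_q) is the Bures–Wasserstein gradient of the energy at q. In other words, the expected Bregman divergence of the potential under the optimal coupling equals the Bures–Wasserstein Bregman divergence of the energy functional. -/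

import Mathlib

open MeasureTheory Matrix Real
open scoped RealInnerProductSpace

noncomputable section

/-- `ℝ^d` as a Euclidean space. -/
abbrev Vec (d : ℕ) := EuclideanSpace ℝ (Fin d)

/-- `d × d` real matrices. -/
abbrev Mat (d : ℕ) := Matrix (Fin d) (Fin d) ℝ

variable {d : ℕ}

/-- Matrix-vector product as a map on Euclidean space. -/
def matVec (A : Mat d) (x : Vec d) : Vec d :=
  (EuclideanSpace.equiv (Fin d) ℝ).symm (A.mulVec (EuclideanSpace.equiv (Fin d) ℝ x))

/-- The Gaussian measure `N(m, S)` on `ℝ^d` with mean `m` and covariance `S`,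
defined via its density with respect to Lebesgue measure.  (For `S` positive
definite this is the usual Gaussian probability measure.) -/
def gaussian (m : Vec d) (S : Mat d) : Measure (Vec d) :=
  volume.withDensity fun x =>
    ENNReal.ofReal (Real.sqrt (((2 * π) ^ d * S.det)⁻¹) *
      Real.exp (-⟪x - m, matVec S⁻¹ (x - m)⟫ / 2))

/-- The Hessian of `f : ℝ^d → ℝ` at `x`, as a `d × d` matrix. -/
def hess (f : Vec d → ℝ) (x : Vec d) : Mat d :=
  Matrix.of fun i j =>
    fderiv ℝ (fun y => fderiv ℝ f y (EuclideanSpace.single j 1)) x (EuclideanSpace.single i 1)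

/-- Frobenius norm of a matrix. -/
def frobNorm (A : Mat d) : ℝ := Real.sqrt (∑ i, ∑ j, (A i j) ^ 2)

/-- Squared Frobenius norm of a matrix. -/
def frobSq (A : Mat d) : ℝ := ∑ i, ∑ j, (A i j) ^ 2

/-- Jacobian of `g : ℝ^d → ℝ^d` at `x`: `(jacobian g x) i j = ∂ g_j / ∂ x_i`. -/
def jacobian (g : Vec d → Vec d) (x : Vec d) : Mat d :=
  Matrix.of fun i j => fderiv ℝ (fun y => g y j) x (EuclideanSpace.single i 1)

/-- Integral of the gradient of `U` against a measure. -/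
def intGrad (U : Vec d → ℝ) (q : Measure (Vec d)) : Vec d := ∫ x, gradient U x ∂q

/-- Entrywise integral of the Hessian of `U` against a measure. -/
def intHess (U : Vec d → ℝ) (q : Measure (Vec d)) : Mat d :=
  Matrix.of fun i j => ∫ x, hess U x i j ∂q

/-- The variational free energy of the Gaussian `N(m,S)`:
`F(m,Σ) = ∫ U dN(m,Σ) − (1/2)·log((2πe)^d · det Σ)`. -/
def freeEnergy (U : Vec d → ℝ) (m : Vec d) (S : Mat d) : ℝ :=
  (∫ x, U x ∂(gaussian m S)) - (1 / 2) * Real.log ((2 * π * Real.exp 1) ^ d * S.det)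

/-- Bregman divergence of `U`: `D_U(x,y) = U(x) − U(y) − ⟨∇U(y), x − y⟩`. -/
def bregman (U : Vec d → ℝ) (x y : Vec d) : ℝ := U x - U y - ⟪gradient U y, x - y⟫

/-- `ψ` is a coupling of `p` and `q`: a probability measure on the product whose
marginals are `p` and `q`. -/
def IsCoupling (ψ : Measure (Vec d × Vec d)) (p q : Measure (Vec d)) : Prop :=
  IsProbabilityMeasure ψ ∧ ψ.map Prod.fst = p ∧ ψ.map Prod.snd = q

lemma matVec_eq_toEuclideanCLM (A : Mat d) (x : Vec d) :
    matVec A x = toEuclideanCLM (𝕜 := ℝ) A x := rfl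

lemma matVec_mul (A B : Mat d) (x : Vec d) : matVec (A * B) x = matVec A (matVec B x) := by
  simp [matVec_eq_toEuclideanCLM]

lemma matVec_one (x : Vec d) : matVec (1 : Mat d) x = x := by
  simp [matVec_eq_toEuclideanCLM]

lemma matVec_apply (A : Mat d) (x : Vec d) (i : Fin d) : matVec A x i = ∑ j, A i j * x j := rfl

lemma inner_eq_sum (x y : Vec d) : ⟪x, y⟫ = ∑ i, x i * y i := by
  simp [PiLp.inner_apply, mul_comm]

lemma inner_matVec_left (A : Mat d) (x y : Vec d) : ⟪matVec A x, y⟫ = ⟪x, matVec Aᵀ y⟫ := by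
  simp only [inner_eq_sum, matVec_apply, Finset.sum_mul, Finset.mul_sum, transpose_apply]
  rw [Finset.sum_comm]
  exact Finset.sum_congr rfl fun i _ => Finset.sum_congr rfl fun j _ => by ring

lemma det_toEuclideanCLM (A : Mat d) :
    (toEuclideanCLM (𝕜 := ℝ) A : Vec d →L[ℝ] Vec d).det = A.det :=
  LinearMap.det_toLpLin 2 A

/-- The density of the standard Gaussian measure on `ℝ^d`. -/
def stdDensity (x : Vec d) : ℝ := Real.sqrt (((2 * π) ^ d)⁻¹) * Real.exp (-(1 / 2) * ‖x‖ ^ 2)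

lemma stdDensity_nonneg (x : Vec d) : 0 ≤ stdDensity x := by
  unfold stdDensity; positivity

lemma continuous_stdDensity : Continuous (stdDensity (d := d)) := by
  unfold stdDensity; fun_prop

lemma gaussian_zero_one :
    gaussian (0 : Vec d) 1 = volume.withDensity fun x => ENNReal.ofReal (stdDensity x) := by
  unfold gaussian stdDensity
  congr with x
  rw [inv_one, matVec_one, sub_zero, real_inner_self_eq_norm_sq, det_one, mul_one]
  ring_nf

lemma integral_gaussian_zero_one (f : Vec d → ℝ) :
    ∫ x, f x ∂(gaussian 0 1) = ∫ x, f x * stdDensity x := by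
  rw [gaussian_zero_one, integral_withDensity_eq_integral_toReal_smul
    (continuous_stdDensity.measurable.ennreal_ofReal) (by simp)]
  simp [ENNReal.toReal_ofReal (stdDensity_nonneg _), mul_comm]

lemma integrable_gaussian_zero_one_iff (f : Vec d → ℝ) :
    Integrable f (gaussian 0 1) ↔ Integrable (fun x => f x * stdDensity x) := by
  rw [gaussian_zero_one, integrable_withDensity_iff
    (continuous_stdDensity.measurable.ennreal_ofReal) (by simp)]
  simp [ENNReal.toReal_ofReal (stdDensity_nonneg _)]

lemma integrable_exp_neg_mul_norm_sq {b : ℝ} (hb : 0 < b) :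
    Integrable (fun x : Vec d => Real.exp (-b * ‖x‖ ^ 2)) := by
  by_contra h
  have h1 := GaussianFourier.integral_rexp_neg_mul_sq_norm (V := Vec d) hb
  rw [integral_undef h] at h1
  have : 0 < (π / b) ^ ((Module.finrank ℝ (Vec d) : ℝ) / 2) := by positivity
  exact this.ne h1

lemma integral_stdDensity : ∫ x : Vec d, stdDensity x = 1 := by
  unfold stdDensity
  rw [integral_const_mul, GaussianFourier.integral_rexp_neg_mul_sq_norm (by norm_num)]
  have h : π / (1 / 2) = 2 * π := by ring
  rw [h, finrank_euclideanSpace_fin, Real.sqrt_inv, Real.sqrt_eq_rpow, ← Real.rpow_natCast,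
    ← Real.rpow_mul (by positivity), mul_one_div]
  exact inv_mul_cancel₀ (by positivity)

instance isProbabilityMeasure_gaussian_zero_one :
    IsProbabilityMeasure (gaussian (0 : Vec d) 1) := by
  constructor
  rw [gaussian_zero_one, withDensity_apply _ .univ, setLIntegral_univ,
    ← ofReal_integral_eq_lintegral_ofReal _ (.of_forall stdDensity_nonneg), integral_stdDensity,
    ENNReal.ofReal_one]
  exact (integrable_exp_neg_mul_norm_sq (by norm_num)).const_mul _

lemma memLp_id_gaussian_zero_one : MemLp id 2 (gaussian (0 : Vec d) 1) := by
  rw [memLp_two_iff_integrable_sq_norm (by fun_prop), integrable_gaussian_zero_one_iff]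
  refine ((integrable_exp_neg_mul_norm_sq (d := d) (b := 1 / 4) (by norm_num)).const_mul
    (4 * Real.sqrt (((2 * π) ^ d)⁻¹))).mono'
    (by have := continuous_stdDensity (d := d); fun_prop) (.of_forall fun x => ?_)
  rw [norm_of_nonneg (by have := stdDensity_nonneg x; positivity), stdDensity]
  have h1 : Real.exp (-(1 / 2) * ‖x‖ ^ 2) =
      Real.exp (-(1 / 4) * ‖x‖ ^ 2) * Real.exp (-(1 / 4) * ‖x‖ ^ 2) := by
    rw [← Real.exp_add]; ring_nf
  have h2 : ‖x‖ ^ 2 * Real.exp (-(1 / 4) * ‖x‖ ^ 2) ≤ 4 := by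
    have h3 := Real.add_one_le_exp (1 / 4 * ‖x‖ ^ 2)
    rw [neg_mul, Real.exp_neg, ← div_eq_mul_inv, div_le_iff₀ (Real.exp_pos _)]
    linarith
  rw [h1]
  calc ‖id x‖ ^ 2 * (Real.sqrt (((2 * π) ^ d)⁻¹) *
        (Real.exp (-(1 / 4) * ‖x‖ ^ 2) * Real.exp (-(1 / 4) * ‖x‖ ^ 2)))
      = (‖x‖ ^ 2 * Real.exp (-(1 / 4) * ‖x‖ ^ 2)) *
        (Real.sqrt (((2 * π) ^ d)⁻¹) * Real.exp (-(1 / 4) * ‖x‖ ^ 2)) := by simp only [id]; ring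
    _ ≤ 4 * (Real.sqrt (((2 * π) ^ d)⁻¹) * Real.exp (-(1 / 4) * ‖x‖ ^ 2)) := by gcongr
    _ = _ := by ring

lemma continuous_matVec (A : Mat d) : Continuous (matVec A) :=
  (toEuclideanCLM (𝕜 := ℝ) A).continuous

lemma gaussian_eq_map (m : Vec d) (A S : Mat d) (hA : A.det ≠ 0) (hAS : A * Aᵀ = S) :
    gaussian m S = (gaussian 0 1).map fun z => m + matVec A z := by
  have hunit : IsUnit A.det := hA.isUnit
  have hmeas : Measurable fun z => m + matVec A z :=
    ((continuous_matVec A).const_add m).measurable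
  have hinv (z : Vec d) : matVec A⁻¹ (matVec A z) = z := by
    rw [← matVec_mul, nonsing_inv_mul _ hunit, matVec_one]
  have hinv' (z : Vec d) : matVec A (matVec A⁻¹ z) = z := by
    rw [← matVec_mul, mul_nonsing_inv _ hunit, matVec_one]
  have hinj : Function.Injective fun z => m + matVec A z := fun x y h => by
    rw [← hinv x, add_left_cancel h, hinv]
  have hsurj : Function.Surjective fun z => m + matVec A z := fun x =>
    ⟨matVec A⁻¹ (x - m), by simp [hinv']⟩
  have hderiv (z : Vec d) : HasFDerivAt (fun z => m + matVec A z)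
      (toEuclideanCLM (𝕜 := ℝ) A : Vec d →L[ℝ] Vec d) z :=
    ((toEuclideanCLM (𝕜 := ℝ) A : Vec d →L[ℝ] Vec d).hasFDerivAt).const_add m
  ext s hs
  rw [Measure.map_apply hmeas hs, gaussian_zero_one, gaussian, withDensity_apply _ hs,
    withDensity_apply _ (hmeas hs)]
  conv_lhs => rw [← Set.image_preimage_eq s hsurj]
  rw [lintegral_image_eq_lintegral_abs_det_fderiv_mul volume (hmeas hs)
    (fun z _ => (hderiv z).hasFDerivWithinAt) hinj.injOn]
  refine lintegral_congr fun z => ?_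
  rw [← ENNReal.ofReal_mul (abs_nonneg _), det_toEuclideanCLM]
  congr 1
  have hdet : S.det = A.det ^ 2 := by rw [← hAS, det_mul, det_transpose]; ring
  have hquad : ⟪matVec A z, matVec S⁻¹ (matVec A z)⟫ = ‖z‖ ^ 2 := by
    rw [← hAS, Matrix.mul_inv_rev, matVec_mul, hinv, inner_matVec_left, ← matVec_mul,
      mul_nonsing_inv, matVec_one, real_inner_self_eq_norm_sq]
    rwa [det_transpose]
  rw [add_sub_cancel_left, hquad, hdet, stdDensity, mul_inv, Real.sqrt_mul (by positivity),
    Real.sqrt_inv (A.det ^ 2), Real.sqrt_sq_eq_abs]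
  have : |A.det| ≠ 0 := abs_ne_zero.2 hA
  field_simp

lemma memLp_two_of_fderiv_bounded {ν : Measure (Vec d)} [IsFiniteMeasure ν] (hν : MemLp id 2 ν)
    {f : Vec d → ℝ} (hf : Differentiable ℝ f) {K : ℝ} (hK : ∀ x, ‖fderiv ℝ f x‖ ≤ K) :
    MemLp f 2 ν := by
  have h1 : MemLp (fun x => f x - f 0) 2 ν := by
    refine hν.of_le_mul (c := K) (hf.continuous.sub continuous_const).aestronglyMeasurable
      (.of_forall fun x => ?_)
    simpa using convex_univ.norm_image_sub_le_of_norm_fderiv_le (fun y _ => hf y)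
      (fun y _ => hK y) (Set.mem_univ 0) (Set.mem_univ x)
  exact (h1.add (memLp_const (f 0))).congr_norm hf.continuous.aestronglyMeasurable (by simp)

lemma fderiv_stdDensity (x v : Vec d) : fderiv ℝ stdDensity x v = -(⟪x, v⟫ * stdDensity x) := by
  have h := (((hasStrictFDerivAt_norm_sq x).hasFDerivAt.const_mul (-(1 / 2) : ℝ)).exp).const_mul
    (Real.sqrt (((2 * π) ^ d)⁻¹))
  have h' : fderiv ℝ stdDensity x = _ := h.fderiv
  rw [h']
  simp [stdDensity]
  ring

lemma differentiable_stdDensity : Differentiable ℝ (stdDensity (d := d)) := by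
  unfold stdDensity
  exact ((((contDiff_norm_sq ℝ (n := 1)).differentiable (by simp)).const_mul _).exp).const_mul _

lemma stein_gaussian_zero_one {f : Vec d → ℝ} (hf : ContDiff ℝ 1 f) {K : ℝ}
    (hK : ∀ x, ‖fderiv ℝ f x‖ ≤ K) (v : Vec d) :
    ∫ z, f z * ⟪z, v⟫ ∂(gaussian 0 1) = ∫ z, fderiv ℝ f z v ∂(gaussian 0 1) := by
  have hd := hf.differentiable (by simp)
  have hf2 : MemLp f 2 (gaussian 0 1) :=
    memLp_two_of_fderiv_bounded memLp_id_gaussian_zero_one hd hK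
  have hv2 : MemLp (fun z : Vec d => ⟪z, v⟫) 2 (gaussian 0 1) :=
    memLp_id_gaussian_zero_one.inner_const v
  have hf' : Integrable (fun z => fderiv ℝ f z v) (gaussian 0 1) := by
    refine Integrable.of_bound ((hf.continuous_fderiv (by simp)).clm_apply
      continuous_const).aestronglyMeasurable (K * ‖v‖) (.of_forall fun x => ?_)
    exact (fderiv ℝ f x).le_of_opNorm_le (hK x) v
  have i1 := (integrable_gaussian_zero_one_iff _).1 hf'
  have i2 := (integrable_gaussian_zero_one_iff _).1 (hf2.integrable_mul hv2)
  have i3 := (integrable_gaussian_zero_one_iff _).1 (hf2.integrable one_le_two)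
  have h := integral_mul_fderiv_eq_neg_fderiv_mul_of_integrable (f := f) (g := stdDensity) (v := v)
    i1 (by simpa [fderiv_stdDensity, mul_assoc] using i2.neg) i3 (fun x _ => hd x)
    (fun x _ => differentiable_stdDensity x)
  rw [integral_gaussian_zero_one, integral_gaussian_zero_one, ← neg_inj, ← h, ← integral_neg]
  simp [fderiv_stdDensity, mul_assoc]

section Gaussian

variable {m : Vec d} {A S : Mat d}

lemma isProbabilityMeasure_gaussian (hA : A.det ≠ 0) (hAS : A * Aᵀ = S) :
    IsProbabilityMeasure (gaussian m S) := by
  rw [gaussian_eq_map m A S hA hAS]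
  exact Measure.isProbabilityMeasure_map ((continuous_matVec A).const_add m).aemeasurable

lemma memLp_id_gaussian (hA : A.det ≠ 0) (hAS : A * Aᵀ = S) :
    MemLp id 2 (gaussian m S) := by
  rw [gaussian_eq_map m A S hA hAS, memLp_map_measure_iff (by fun_prop)
    ((continuous_matVec A).const_add m).aemeasurable]
  exact (memLp_const m).add
    ((toEuclideanCLM (𝕜 := ℝ) A : Vec d →L[ℝ] Vec d).comp_memLp' memLp_id_gaussian_zero_one)

/-- Stein's identity for `N(m, S)`. -/
lemma stein_gaussian (hA : A.det ≠ 0) (hAS : A * Aᵀ = S) {f : Vec d → ℝ} (hf : ContDiff ℝ 1 f)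
    {K : ℝ} (hK : ∀ x, ‖fderiv ℝ f x‖ ≤ K) (w : Vec d) :
    ∫ y, f y * ⟪y - m, w⟫ ∂(gaussian m S) = ∫ y, fderiv ℝ f y (matVec S w) ∂(gaussian m S) := by
  have hmap := ((continuous_matVec A).const_add m)
  have hd := hf.differentiable (by simp)
  have hf' := hf.continuous_fderiv (by simp)
  rw [gaussian_eq_map m A S hA hAS, integral_map hmap.aemeasurable
    (by have := hf.continuous; fun_prop), integral_map hmap.aemeasurable (by fun_prop)]
  have hderiv (z : Vec d) : HasFDerivAt (fun z => m + matVec A z)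
      (toEuclideanCLM (𝕜 := ℝ) A : Vec d →L[ℝ] Vec d) z :=
    ((toEuclideanCLM (𝕜 := ℝ) A : Vec d →L[ℝ] Vec d).hasFDerivAt).const_add m
  have hcomp (z : Vec d) : fderiv ℝ (fun z => f (m + matVec A z)) z =
      (fderiv ℝ f (m + matVec A z)).comp (toEuclideanCLM (𝕜 := ℝ) A : Vec d →L[ℝ] Vec d) :=
    ((hd _).hasFDerivAt.comp z (hderiv z)).fderiv
  have hsmooth : ContDiff ℝ 1 (fun z => f (m + matVec A z)) :=
    hf.comp (contDiff_const.add (toEuclideanCLM (𝕜 := ℝ) A : Vec d →L[ℝ] Vec d).contDiff)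
  have h := stein_gaussian_zero_one hsmooth
    (K := K * ‖(toEuclideanCLM (𝕜 := ℝ) A : Vec d →L[ℝ] Vec d)‖) (fun z => by
      rw [hcomp]
      refine (ContinuousLinearMap.opNorm_comp_le _ _).trans ?_
      gcongr
      exact hK _) (matVec Aᵀ w)
  simp_rw [hcomp] at h
  simp_rw [add_sub_cancel_left, inner_matVec_left, h, ← hAS, matVec_mul]
  rfl

lemma integral_sub_affine_mul_affine_eq_zero (hA : A.det ≠ 0) (hAS : A * Aᵀ = S)
    {f : Vec d → ℝ} (hf : ContDiff ℝ 1 f) {K : ℝ} (hK : ∀ x, ‖fderiv ℝ f x‖ ≤ K) (h : Vec d)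
    (hh : ∀ v, ∫ y, fderiv ℝ f y v ∂(gaussian m S) = ⟪h, v⟫) (c : ℝ) (w : Vec d) :
    Integrable (fun y => (f y - (∫ x, f x ∂(gaussian m S) + ⟪h, y - m⟫)) * (c + ⟪w, y - m⟫))
      (gaussian m S) ∧
    ∫ y, (f y - (∫ x, f x ∂(gaussian m S) + ⟪h, y - m⟫)) * (c + ⟪w, y - m⟫) ∂(gaussian m S)
      = 0 := by
  have : IsProbabilityMeasure (gaussian m S) := isProbabilityMeasure_gaussian hA hAS
  have hid : MemLp id 2 (gaussian m S) := memLp_id_gaussian hA hAS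
  have hd := hf.differentiable (by simp)
  set g := ∫ x, f x ∂(gaussian m S)
  have haff (u : Vec d) : MemLp (fun y => ⟪u, y - m⟫) 2 (gaussian m S) :=
    (hid.sub (memLp_const m)).const_inner u
  have hmean (u : Vec d) : ∫ y, ⟪u, y - m⟫ ∂(gaussian m S) = 0 := by
    have := stein_gaussian (m := m) hA hAS (f := fun _ => 1) contDiff_const (K := 0) (by simp) u
    simpa [real_inner_comm] using this
  have hf2 : MemLp f 2 (gaussian m S) := memLp_two_of_fderiv_bounded hid hd hK
  set F : Vec d → ℝ := fun y => f y - (g + ⟪h, y - m⟫)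
  have hF2 : MemLp F 2 (gaussian m S) := hf2.sub ((memLp_const g).add (haff h))
  have hFsmooth : ContDiff ℝ 1 F := by
    refine hf.sub (contDiff_const.add (contDiff_const.inner ℝ (contDiff_id.sub contDiff_const)))
  have hFderiv (y : Vec d) : fderiv ℝ F y = fderiv ℝ f y - innerSL ℝ h := by
    have h1 : HasFDerivAt (fun y => g + ⟪h, y - m⟫) (innerSL ℝ h) y :=
      (((innerSL ℝ h).hasFDerivAt.comp y ((hasFDerivAt_id y).sub_const m))).const_add g
    exact ((hd y).hasFDerivAt.sub h1).fderiv
  have hFint : ∫ y, F y ∂(gaussian m S) = 0 := by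
    change ∫ y, f y - (g + ⟪h, y - m⟫) ∂(gaussian m S) = 0
    rw [integral_sub (g := fun y => g + ⟪h, y - m⟫) (hf2.integrable one_le_two)
      ((integrable_const g).add ((haff h).integrable one_le_two)),
      integral_add (integrable_const g) ((haff h).integrable one_le_two), hmean]
    simp [g]
  have hfi (v : Vec d) : Integrable (fun y => fderiv ℝ f y v) (gaussian m S) := by
    refine Integrable.of_bound ((hf.continuous_fderiv (by simp)).clm_apply
      continuous_const).aestronglyMeasurable (K * ‖v‖) (.of_forall fun x => ?_)
    exact (fderiv ℝ f x).le_of_opNorm_le (hK x) v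
  have hstein : ∫ y, F y * ⟪w, y - m⟫ ∂(gaussian m S) = 0 := by
    have h1 := stein_gaussian (m := m) hA hAS hFsmooth (K := K + ‖innerSL ℝ h‖) (fun y => by
      rw [hFderiv]
      exact (norm_sub_le _ _).trans (by gcongr; exact hK y)) w
    simp_rw [real_inner_comm] at h1
    rw [h1]
    simp_rw [hFderiv, _root_.sub_apply, innerSL_apply_apply]
    rw [integral_sub (hfi _) (integrable_const _), hh]
    simp
  have i1 : Integrable (fun y => F y * c) (gaussian m S) :=
    (hF2.integrable one_le_two).mul_const c
  have i2 : Integrable (fun y => F y * ⟪w, y - m⟫) (gaussian m S) := hF2.integrable_mul (haff w)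
  simp_rw [mul_add]
  refine ⟨i1.add i2, ?_⟩
  rw [integral_add i1 i2, integral_mul_const, hFint, hstein]
  simp

end Gaussian

section Potential

variable {U : Vec d → ℝ}

lemma contDiff_fderiv_apply (hU : ContDiff ℝ 2 U) (v : Vec d) :
    ContDiff ℝ 1 fun y => fderiv ℝ U y v :=
  (hU.fderiv_right (by norm_num)).clm_apply contDiff_const

lemma clm_apply_eq_sum (φ : Vec d →L[ℝ] ℝ) (v : Vec d) :
    φ v = ∑ i, v i * φ (EuclideanSpace.single i 1) := by
  conv_lhs => rw [← (EuclideanSpace.basisFun (Fin d) ℝ).sum_repr v]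
  simp [map_sum]

lemma fderiv_fderiv_single_apply (U : Vec d → ℝ) (x v : Vec d) (j : Fin d) :
    fderiv ℝ (fun y => fderiv ℝ U y (EuclideanSpace.single j 1)) x v =
      ∑ i, v i * hess U x i j :=
  clm_apply_eq_sum _ v

lemma norm_le_of_abs_apply_single_le {φ : Vec d →L[ℝ] ℝ} {C : ℝ} (hC : 0 ≤ C)
    (h : ∀ i, |φ (EuclideanSpace.single i 1)| ≤ C) : ‖φ‖ ≤ d * C := by
  refine φ.opNorm_le_bound (by positivity) fun v => ?_
  rw [clm_apply_eq_sum, Real.norm_eq_abs]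
  calc |∑ i, v i * φ (EuclideanSpace.single i 1)|
      ≤ ∑ i, |v i * φ (EuclideanSpace.single i 1)| := Finset.abs_sum_le_sum_abs _ _
    _ ≤ ∑ _i : Fin d, ‖v‖ * C := Finset.sum_le_sum fun i _ => by
        rw [abs_mul]
        exact mul_le_mul (PiLp.norm_apply_le v i) (h i) (abs_nonneg _) (norm_nonneg _)
    _ = d * C * ‖v‖ := by simp; ring

lemma abs_apply_le_of_posSemidef_sub {H : Mat d} {L : ℝ} (h0 : H.PosSemidef)
    (hL : (L • (1 : Mat d) - H).PosSemidef) (i j : Fin d) : |H i j| ≤ L := by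
  have hsymm : H j i = H i j := h0.1.apply i j
  rcases eq_or_ne i j with rfl | hij
  · have h1 := h0.diag_nonneg (i := i)
    have h2 := hL.diag_nonneg (i := i)
    simp at h2
    rw [abs_of_nonneg h1]
    linarith
  have key (M : Mat d) (s : ℝ) : star (Pi.single i 1 + Pi.single j s) ⬝ᵥ
      M.mulVec (Pi.single i 1 + Pi.single j s) =
        M i i + s * M i j + s * M j i + s ^ 2 * M j j := by
    simp [mulVec_add, add_dotProduct, dotProduct_add]
    ring
  have h1 := h0.dotProduct_mulVec_nonneg (Pi.single i 1 + Pi.single j 1)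
  have h2 := h0.dotProduct_mulVec_nonneg (Pi.single i 1 + Pi.single j (-1))
  have h3 := hL.diag_nonneg (i := i)
  have h4 := hL.diag_nonneg (i := j)
  rw [key] at h1 h2
  simp at h3 h4
  rw [abs_le]
  constructor <;> nlinarith

lemma integrable_of_norm_fderiv_le {ν : Measure (Vec d)} [IsFiniteMeasure ν] (hν : MemLp id 2 ν)
    (hU : Differentiable ℝ U) {a b : ℝ} (hb : 0 ≤ b) (h : ∀ x, ‖fderiv ℝ U x‖ ≤ a + b * ‖x‖) :
    Integrable U ν := by
  have i1 : Integrable (fun x : Vec d => ‖x‖) ν := (hν.integrable one_le_two).norm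
  have i2 : Integrable (fun x : Vec d => ‖x‖ ^ 2) ν :=
    (memLp_two_iff_integrable_sq_norm (by fun_prop)).1 hν
  refine ((integrable_const |U 0|).add ((i1.const_mul a).add (i2.const_mul b))).mono'
    hU.continuous.aestronglyMeasurable (.of_forall fun x => ?_)
  have h1 := (convex_closedBall (0 : Vec d) ‖x‖).norm_image_sub_le_of_norm_fderiv_le (f := U)
    (C := a + b * ‖x‖) (fun y _ => hU y)
    (fun y hy => (h y).trans (by gcongr; simpa using hy)) (x := 0) (y := x) (by simp) (by simp)
  have h2 := norm_sub_norm_le (U x) (U 0)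
  simp only [Pi.add_apply, sub_zero, Real.norm_eq_abs] at *
  nlinarith

lemma norm_fderiv_le_of_hess_bounded (hU : ContDiff ℝ 2 U) {L : ℝ} (hL : 0 ≤ L)
    (hentry : ∀ x i j, |hess U x i j| ≤ L) (x : Vec d) :
    ‖fderiv ℝ U x‖ ≤ d * ∑ j, |fderiv ℝ U 0 (EuclideanSpace.single j 1)| +
      d * (d * L) * ‖x‖ := by
  let f : Fin d → Vec d → ℝ := fun j y => fderiv ℝ U y (EuclideanSpace.single j 1)
  have hfK (j : Fin d) (x : Vec d) : ‖fderiv ℝ (f j) x‖ ≤ d * L :=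
    norm_le_of_abs_apply_single_le hL fun i => hentry x i j
  have hfd (j : Fin d) : Differentiable ℝ (f j) :=
    (contDiff_fderiv_apply hU _).differentiable (by simp)
  rw [mul_assoc, ← mul_add]
  refine norm_le_of_abs_apply_single_le (by positivity) fun j => ?_
  have h1 := convex_univ.norm_image_sub_le_of_norm_fderiv_le (fun y _ => hfd j y)
    (fun y _ => hfK j y) (Set.mem_univ 0) (Set.mem_univ x)
  have h2 := norm_sub_norm_le (f j x) (f j 0)
  have h3 := Finset.single_le_sum (f := fun j => |f j 0|) (fun j _ => abs_nonneg _)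
    (Finset.mem_univ j)
  simp only [sub_zero, Real.norm_eq_abs] at h1 h2 h3
  change |f j x| ≤ _
  linarith

/-- Under a Gaussian measure, the gradient of `U` and its Bures–Wasserstein gradient have the same
pairing with every affine map. -/
lemma integral_inner_gradient_affine (hU : ContDiff ℝ 2 U) {L : ℝ} (hL : 0 ≤ L)
    (hentry : ∀ x i j, |hess U x i j| ≤ L) (hsymm : ∀ x, (hess U x).IsHermitian)
    {m : Vec d} {A S : Mat d} (hA : A.det ≠ 0) (hAS : A * Aᵀ = S) (c : Vec d) (B : Mat d) :
    Integrable (fun y => ⟪gradient U y, c + matVec B (y - m)⟫) (gaussian m S) ∧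
    ∫ y, ⟪intGrad U (gaussian m S) + matVec (intHess U (gaussian m S)) (y - m),
        c + matVec B (y - m)⟫ ∂(gaussian m S) =
      ∫ y, ⟪gradient U y, c + matVec B (y - m)⟫ ∂(gaussian m S) := by
  have : IsProbabilityMeasure (gaussian m S) := isProbabilityMeasure_gaussian hA hAS
  have hid : MemLp id 2 (gaussian m S) := memLp_id_gaussian hA hAS
  let f : Fin d → Vec d → ℝ := fun j y => fderiv ℝ U y (EuclideanSpace.single j 1)
  have hf (j : Fin d) : ContDiff ℝ 1 (f j) := contDiff_fderiv_apply hU _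
  have hfK (j : Fin d) (x : Vec d) : ‖fderiv ℝ (f j) x‖ ≤ d * L :=
    norm_le_of_abs_apply_single_le hL fun i => hentry x i j
  have hfd (j : Fin d) : Differentiable ℝ (f j) := (hf j).differentiable (by simp)
  have hf2 (j : Fin d) : MemLp (f j) 2 (gaussian m S) :=
    memLp_two_of_fderiv_bounded hid (hfd j) (hfK j)
  have hgrad (x : Vec d) (j : Fin d) : gradient U x j = f j x := by
    change _ = fderiv ℝ U x _
    rw [← inner_gradient_left (𝕜 := ℝ), EuclideanSpace.inner_single_right]
    simp
  let h : Fin d → Vec d := fun j => WithLp.toLp 2 (intHess U (gaussian m S) j)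
  let w : Fin d → Vec d := fun j => WithLp.toLp 2 (B j)
  have hB (y : Vec d) (j : Fin d) : (c + matVec B (y - m)) j = c j + ⟪w j, y - m⟫ := by
    rw [inner_eq_sum]; rfl
  have hg (j : Fin d) : intGrad U (gaussian m S) j = ∫ y, f j y ∂(gaussian m S) := by
    rw [intGrad, eval_integral_piLp]
    · simp only [hgrad]
    · intro j
      simpa only [hgrad] using (hf2 j).integrable one_le_two
  have hG (y : Vec d) (j : Fin d) :
      (intGrad U (gaussian m S) + matVec (intHess U (gaussian m S)) (y - m)) j =
        ∫ y, f j y ∂(gaussian m S) + ⟪h j, y - m⟫ := by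
    rw [← hg, inner_eq_sum]; rfl
  have hhess (i j : Fin d) : Integrable (fun y => hess U y i j) (gaussian m S) :=
    Integrable.of_bound (((hf j).continuous_fderiv (by simp)).clm_apply
      continuous_const).aestronglyMeasurable L (.of_forall fun x => hentry x i j)
  have hh (j : Fin d) (v : Vec d) :
      ∫ y, fderiv ℝ (f j) y v ∂(gaussian m S) = ⟪h j, v⟫ := by
    simp only [f, fderiv_fderiv_single_apply]
    rw [integral_finsetSum _ fun i _ => (hhess i j).const_mul _, inner_eq_sum]
    refine Finset.sum_congr rfl fun i _ => ?_
    rw [integral_const_mul, mul_comm]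
    congr 1
    exact integral_congr_ae (.of_forall fun y => (hsymm y).apply j i)
  have hzero (j : Fin d) := integral_sub_affine_mul_affine_eq_zero hA hAS (hf j) (hfK j) (h j)
    (hh j) (c j) (w j)
  have i1 : Integrable (fun y => ⟪gradient U y, c + matVec B (y - m)⟫) (gaussian m S) := by
    simp_rw [inner_eq_sum (gradient U _), hgrad, hB]
    refine integrable_finsetSum _ fun j _ => ?_
    have h1 : MemLp (fun y => ⟪w j, y - m⟫) 2 (gaussian m S) :=
      (hid.sub (memLp_const m)).const_inner (w j)
    have h2 : MemLp (fun y => c j + ⟪w j, y - m⟫) 2 (gaussian m S) := (memLp_const (c j)).add h1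
    exact (hf2 j).integrable_mul h2
  have hdiff (y : Vec d) : ⟪intGrad U (gaussian m S) + matVec (intHess U (gaussian m S)) (y - m),
      c + matVec B (y - m)⟫ = ⟪gradient U y, c + matVec B (y - m)⟫ -
      ∑ j, (f j y - (∫ x, f j x ∂(gaussian m S) + ⟪h j, y - m⟫)) *
        (c j + ⟪w j, y - m⟫) := by
    rw [inner_eq_sum, inner_eq_sum, ← Finset.sum_sub_distrib]
    refine Finset.sum_congr rfl fun j _ => ?_
    rw [hG, hB, hgrad]
    ring
  refine ⟨i1, ?_⟩
  simp_rw [hdiff]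
  rw [integral_sub i1 (integrable_finsetSum _ fun j _ => (hzero j).1),
    integral_finsetSum _ fun j _ => (hzero j).1, Finset.sum_eq_zero fun j _ => (hzero j).2,
    sub_zero]

end Potential

/-- The optimal transport map between two Gaussian measures pushes one forward to the other. -/
lemma gaussian_eq_map_transport (mp mq : Vec d) {Sp Sq Q R : Mat d} (hSp : Sp.PosDef)
    (hQ : Q.PosDef) (hQ2 : Q * Q = Sq) (hR : R.PosSemidef) (hR2 : R * R = Q * Sp * Q) :
    gaussian mp Sp =
      (gaussian mq Sq).map fun y => mp + matVec (Q⁻¹ * R * Q⁻¹) (y - mq) := by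
  have hQdet : Q.det ≠ 0 := hQ.det_pos.ne'
  have hQunit : IsUnit Q.det := hQdet.isUnit
  have hQT : Qᵀ = Q := hQ.1
  have hRT : Rᵀ = R := hR.1
  have hQS : Q * Qᵀ = Sq := by rw [hQT, hQ2]
  have hRdet : R.det ≠ 0 := fun h0 => by
    have h1 := congrArg Matrix.det hR2
    simp only [det_mul, h0] at h1
    have := hSp.det_pos
    have := hQ.det_pos
    have : 0 < Q.det * Sp.det * Q.det := by positivity
    linarith
  have hA : (Q⁻¹ * R).det ≠ 0 := by
    rw [det_mul]
    exact mul_ne_zero (isUnit_nonsing_inv_det _ hQunit).ne_zero hRdet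
  have hAS : (Q⁻¹ * R) * (Q⁻¹ * R)ᵀ = Sp := by
    rw [transpose_mul, transpose_nonsing_inv, hQT, hRT, Matrix.mul_assoc, ← Matrix.mul_assoc R,
      hR2, Matrix.mul_assoc, mul_nonsing_inv _ hQunit, Matrix.mul_one, ← Matrix.mul_assoc,
      nonsing_inv_mul _ hQunit, Matrix.one_mul]
  have hTcont : Continuous fun y => mp + matVec (Q⁻¹ * R * Q⁻¹) (y - mq) :=
    ((continuous_matVec _).comp (continuous_id.sub continuous_const)).const_add mp
  rw [gaussian_eq_map mp _ Sp hA hAS, gaussian_eq_map mq Q Sq hQdet hQS,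
    Measure.map_map hTcont.measurable ((continuous_matVec Q).const_add mq).measurable]
  congr 1
  ext1 z
  simp only [Function.comp_apply, add_sub_cancel_left]
  rw [← matVec_mul, Matrix.mul_assoc, nonsing_inv_mul _ hQunit, Matrix.mul_one]

/-- **Wasserstein Bregman divergence identity** (Lemma 3.5).  Let
`p = N(m_p, Σ_p)`, `q = N(m_q, Σ_q)`, let `Q = Σ_q^{1/2}` (the unique
positive-definite square root of `Σ_q`) and `R = (Σ_q^{1/2} Σ_p Σ_q^{1/2})^{1/2}`
(the unique positive-semidefinite square root), so that
`T_{q→p}(y) = m_p + Q⁻¹ R Q⁻¹ (y − m_q)` is the optimal transport map from `q`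
to `p`.  Then the expected Bregman divergence of `U` under the optimal coupling
equals the Bures–Wasserstein Bregman divergence of the energy:
`E_{Y∼q}[D_U(T(Y), Y)] = ∫U dp − ∫U dq − E_{Y∼q}⟨G_q(Y), T(Y) − Y⟩`, where
`G_q(y) = ∫∇U dq + (∫∇²U dq)(y − m_q)`. -/
theorem wasserstein_bregman_identity
    (d : ℕ) (hd : 0 < d) (U : Vec d → ℝ) (μ L : ℝ) (hμ : 0 < μ) (hμL : μ ≤ L)
    (hU : ContDiff ℝ 2 U)
    (hconv : ∀ x : Vec d,
      (hess U x - μ • 1).PosSemidef ∧ ((L • (1 : Mat d)) - hess U x).PosSemidef)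
    (mp mq : Vec d) (Sp Sq : Mat d) (hSp : Sp.PosDef) (hSq : Sq.PosDef)
    (Q : Mat d) (hQ : Q.PosDef) (hQ2 : Q * Q = Sq)
    (R : Mat d) (hR : R.PosSemidef) (hR2 : R * R = Q * Sp * Q) :
    let T : Vec d → Vec d := fun y => mp + matVec (Q⁻¹ * R * Q⁻¹) (y - mq)
    let G : Vec d → Vec d := fun y =>
      intGrad U (gaussian mq Sq) + matVec (intHess U (gaussian mq Sq)) (y - mq)
    (∫ y, bregman U (T y) y ∂(gaussian mq Sq))
      = (∫ x, U x ∂(gaussian mp Sp)) - (∫ x, U x ∂(gaussian mq Sq))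
        - ∫ y, ⟪G y, T y - y⟫ ∂(gaussian mq Sq) := by
  intro T G
  have hQdet : Q.det ≠ 0 := hQ.det_pos.ne'
  have hQS : Q * Qᵀ = Sq := by rw [show Qᵀ = Q from hQ.1, hQ2]
  have hTcont : Continuous T :=
    ((continuous_matVec _).comp (continuous_id.sub continuous_const)).const_add mp
  have hmap : gaussian mp Sp = (gaussian mq Sq).map T :=
    gaussian_eq_map_transport mp mq hSp hQ hQ2 hR hR2
  have hprobq : IsProbabilityMeasure (gaussian mq Sq) := isProbabilityMeasure_gaussian hQdet hQS
  have hprobp : IsProbabilityMeasure (gaussian mp Sp) := by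
    rw [hmap]
    exact Measure.isProbabilityMeasure_map hTcont.aemeasurable
  have hidq : MemLp id 2 (gaussian mq Sq) := memLp_id_gaussian hQdet hQS
  have hidp : MemLp id 2 (gaussian mp Sp) := by
    rw [hmap, memLp_map_measure_iff (by fun_prop) hTcont.aemeasurable]
    exact (memLp_const mp).add ((toEuclideanCLM (𝕜 := ℝ) (Q⁻¹ * R * Q⁻¹) :
      Vec d →L[ℝ] Vec d).comp_memLp' (hidq.sub (memLp_const mq)))
  have hUd : Differentiable ℝ U := hU.differentiable (by norm_num)
  have hpsd (x : Vec d) : (hess U x).PosSemidef := by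
    simpa using (hconv x).1.add (PosSemidef.one.smul hμ.le)
  have hentry (x : Vec d) (i j : Fin d) : |hess U x i j| ≤ L :=
    abs_apply_le_of_posSemidef_sub (hpsd x) (hconv x).2 i j
  have hL : 0 ≤ L := hμ.le.trans hμL
  have hgrowth := norm_fderiv_le_of_hess_bounded hU hL hentry
  have hUq : Integrable U (gaussian mq Sq) :=
    integrable_of_norm_fderiv_le hidq hUd (by positivity) hgrowth
  have hUp : Integrable U (gaussian mp Sp) :=
    integrable_of_norm_fderiv_le hidp hUd (by positivity) hgrowth
  have hUT : Integrable (fun y => U (T y)) (gaussian mq Sq) :=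
    (integrable_map_measure hUd.continuous.aestronglyMeasurable hTcont.aemeasurable).1 (hmap ▸ hUp)
  have hUTint : ∫ y, U (T y) ∂(gaussian mq Sq) = ∫ x, U x ∂(gaussian mp Sp) := by
    rw [hmap, integral_map hTcont.aemeasurable hUd.continuous.aestronglyMeasurable]
  have hT (y : Vec d) : T y - y = mp - mq + matVec (Q⁻¹ * R * Q⁻¹ - 1) (y - mq) := by
    simp only [T, matVec_eq_toEuclideanCLM, map_sub, map_one, _root_.sub_apply,
      one_apply_eq_self]
    abel
  obtain ⟨i1, hGint⟩ := integral_inner_gradient_affine hU hL hentry (fun x => (hpsd x).1)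
    (m := mq) hQdet hQS (mp - mq) (Q⁻¹ * R * Q⁻¹ - 1)
  simp only [← hT] at i1 hGint
  rw [hGint, ← hUTint, ← integral_sub hUT hUq,
    ← integral_sub (f := fun y => U (T y) - U y) (hUT.sub hUq) i1]
  rfl
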